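/- arXiv:1104.1541 — 9 statements merged into one kernel-verified Lean document; each statement's English description precedes it below -/
import Mathlib

section
/- Let α > 0 and let p, q be probability density functions on ℝ^d with respect to Lebesgue measure λ such that ∫ p^{1+α} dλ and ∫ q^{1+α} dλ are finite and ∫ p^α q dλ is finite and positive. Then the quantity R_α(P,Q) = (1/α)·[ ln( (∫ p^{1+α} dλ)^{α/(1+α)} · (∫ q^{1+α} dλ)^{1/(1+α)} ) − ln ∫ p^α q dλ ] is nonnegative, and R_α(P,Q) = 0 if and only if p = q λ-almost everywhere. -/
open MeasureTheory

section Holder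

variable {X : Type*} [MeasurableSpace X] {μ : Measure X} {s t : ℝ} {f g : X → ℝ}

theorem integrable_rpow_mul_rpow (hs : 0 < s) (ht : 0 < t) (hst : s + t = 1)
    (hf0 : ∀ x, 0 ≤ f x) (hg0 : ∀ x, 0 ≤ g x) (hf : Integrable f μ) (hg : Integrable g μ) :
    Integrable (fun x => f x ^ s * g x ^ t) μ := by
  refine ((hf.const_mul s).add (hg.const_mul t)).mono'
    ((hf.aemeasurable.pow_const s).mul (hg.aemeasurable.pow_const t)).aestronglyMeasurable
    (.of_forall fun x => ?_)
  rw [Real.norm_of_nonneg (mul_nonneg (Real.rpow_nonneg (hf0 x) s) (Real.rpow_nonneg (hg0 x) t))]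
  exact Real.geom_mean_le_arith_mean2_weighted hs.le ht.le (hf0 x) (hg0 x) hst

/-- Hölder's inequality with its equality case, for functions of integral one. -/
theorem integral_rpow_mul_rpow_le_one_and_eq_one_iff (hs : 0 < s) (ht : 0 < t) (hst : s + t = 1)
    (hf0 : ∀ x, 0 ≤ f x) (hg0 : ∀ x, 0 ≤ g x) (hf : Integrable f μ) (hg : Integrable g μ)
    (hf1 : ∫ x, f x ∂μ = 1) (hg1 : ∫ x, g x ∂μ = 1) :
    ∫ x, f x ^ s * g x ^ t ∂μ ≤ 1 ∧ (∫ x, f x ^ s * g x ^ t ∂μ = 1 ↔ f =ᵐ[μ] g) := by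
  have young : ∀ x, f x ^ s * g x ^ t ≤ s * f x + t * g x := fun x =>
    Real.geom_mean_le_arith_mean2_weighted hs.le ht.le (hf0 x) (hg0 x) hst
  have hint := integrable_rpow_mul_rpow hs ht hst hf0 hg0 hf hg
  have hsum : Integrable (fun x => s * f x + t * g x) μ :=
    (hf.const_mul s).add (hg.const_mul t)
  have hsum1 : ∫ x, (s * f x + t * g x) ∂μ = 1 := by
    rw [integral_add (hf.const_mul s) (hg.const_mul t), integral_const_mul, integral_const_mul,
      hf1, hg1, mul_one, mul_one, hst]
  refine ⟨hsum1 ▸ integral_mono hint hsum young, ?_⟩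
  rw [← hsum1, integral_eq_iff_of_ae_le hint hsum (.of_forall young)]
  refine Filter.eventually_congr (.of_forall fun x => ?_)
  exact Real.geom_mean_eq_arith_mean2_weighted_iff_of_pos hs ht (hf0 x) (hg0 x) hst

/-- Hölder's inequality with its equality case. -/
theorem integral_rpow_mul_rpow_le_and_eq_iff (hs : 0 < s) (ht : 0 < t) (hst : s + t = 1)
    (hf0 : ∀ x, 0 ≤ f x) (hg0 : ∀ x, 0 ≤ g x) (hf : Integrable f μ) (hg : Integrable g μ)
    (hfpos : 0 < ∫ x, f x ∂μ) (hgpos : 0 < ∫ x, g x ∂μ) :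
    ∫ x, f x ^ s * g x ^ t ∂μ ≤ (∫ x, f x ∂μ) ^ s * (∫ x, g x ∂μ) ^ t ∧
      (∫ x, f x ^ s * g x ^ t ∂μ = (∫ x, f x ∂μ) ^ s * (∫ x, g x ∂μ) ^ t ↔
        ∀ᵐ x ∂μ, f x / ∫ y, f y ∂μ = g x / ∫ y, g y ∂μ) := by
  set A := ∫ x, f x ∂μ with hA
  set B := ∫ x, g x ∂μ with hB
  have hC : 0 < A ^ s * B ^ t := by positivity
  have key := integral_rpow_mul_rpow_le_one_and_eq_one_iff hs ht hst
    (fun x => div_nonneg (hf0 x) hfpos.le) (fun x => div_nonneg (hg0 x) hgpos.le)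
    (hf.div_const A) (hg.div_const B)
    (by rw [integral_div, ← hA, div_self hfpos.ne'])
    (by rw [integral_div, ← hB, div_self hgpos.ne'])
  have scale : ∫ x, (f x / A) ^ s * (g x / B) ^ t ∂μ
      = (∫ x, f x ^ s * g x ^ t ∂μ) / (A ^ s * B ^ t) := by
    rw [← integral_div]
    refine integral_congr_ae (.of_forall fun x => ?_)
    simp only [Real.div_rpow (hf0 x) hfpos.le, Real.div_rpow (hg0 x) hgpos.le, div_mul_div_comm]
  rwa [scale, div_le_one hC, div_eq_one_iff_eq hC.ne'] at key

end Holder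

theorem integral_rpow_pos_of_integral_eq_one {X : Type*} [MeasurableSpace X] {μ : Measure X}
    {p : X → ℝ} {r : ℝ} (hr : r ≠ 0) (hp0 : ∀ x, 0 ≤ p x) (hp1 : ∫ x, p x ∂μ = 1)
    (hp : Integrable (fun x => p x ^ r) μ) : 0 < ∫ x, p x ^ r ∂μ := by
  have hnn : ∀ x, 0 ≤ p x ^ r := fun x => Real.rpow_nonneg (hp0 x) r
  refine (integral_nonneg hnn).lt_of_ne' fun h => ?_
  rw [integral_eq_zero_iff_of_nonneg hnn hp] at h
  have hp_zero : p =ᵐ[μ] 0 := h.mono fun x hx => (Real.rpow_eq_zero (hp0 x) hr).1 hx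
  simp [integral_congr_ae hp_zero] at hp1

/-- Two densities whose `r`-th powers are proportional coincide. -/
theorem ae_eq_iff_ae_rpow_div_integral_eq {X : Type*} [MeasurableSpace X] {μ : Measure X}
    {p q : X → ℝ} {r : ℝ} (hr : r ≠ 0) (hp0 : ∀ x, 0 ≤ p x) (hq0 : ∀ x, 0 ≤ q x)
    (hp1 : ∫ x, p x ∂μ = 1) (hq1 : ∫ x, q x ∂μ = 1)
    (hp : Integrable (fun x => p x ^ r) μ) (hq : Integrable (fun x => q x ^ r) μ) :
    (∀ᵐ x ∂μ, p x ^ r / ∫ y, p y ^ r ∂μ = q x ^ r / ∫ y, q y ^ r ∂μ) ↔ p =ᵐ[μ] q := by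
  have hA := integral_rpow_pos_of_integral_eq_one hr hp0 hp1 hp
  have hB := integral_rpow_pos_of_integral_eq_one hr hq0 hq1 hq
  constructor
  · intro h
    set A := ∫ y, p y ^ r ∂μ
    set B := ∫ y, q y ^ r ∂μ
    have hpq : ∀ᵐ x ∂μ, p x = (A / B) ^ r⁻¹ * q x := by
      filter_upwards [h] with x hx
      have hx' : p x ^ r = A / B * q x ^ r := by
        rw [div_eq_iff hA.ne'] at hx
        rw [hx]
        ring
      rw [← Real.rpow_rpow_inv (hp0 x) hr, hx', Real.mul_rpow (by positivity)
        (Real.rpow_nonneg (hq0 x) r), Real.rpow_rpow_inv (hq0 x) hr]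
    have hc : (A / B) ^ r⁻¹ = 1 := by
      have := integral_congr_ae hpq
      rw [integral_const_mul, hp1, hq1, mul_one] at this
      exact this.symm
    filter_upwards [hpq] with x hx
    rw [hx, hc, one_mul]
  · intro h
    have hAB : ∫ y, p y ^ r ∂μ = ∫ y, q y ^ r ∂μ :=
      integral_congr_ae (h.mono fun x hx => by simp only [hx])
    filter_upwards [h] with x hx
    rw [hAB, hx]

/-- Nonnegativity of the pseudodistance `R_α` of order `α > 0`, and vanishing iff the two
densities coincide almost everywhere. -/
theorem Ralpha_nonneg_and_eq_zero_iff {d : ℕ} (α : ℝ) (hα : 0 < α)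
    (p q : (Fin d → ℝ) → ℝ)
    (hpmeas : Measurable p) (hqmeas : Measurable q)
    (hpnn : ∀ x, 0 ≤ p x) (hqnn : ∀ x, 0 ≤ q x)
    (hpdens : ∫ x, p x = 1) (hqdens : ∫ x, q x = 1)
    (hpint : Integrable (fun x => p x ^ (1 + α)))
    (hqint : Integrable (fun x => q x ^ (1 + α)))
    (hpqint : Integrable (fun x => p x ^ α * q x))
    (hpqpos : 0 < ∫ x, p x ^ α * q x) :
    0 ≤ (1 / α) * (Real.log ((∫ x, p x ^ (1 + α)) ^ (α / (1 + α)) *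
          (∫ x, q x ^ (1 + α)) ^ (1 / (1 + α))) - Real.log (∫ x, p x ^ α * q x)) ∧
      ((1 / α) * (Real.log ((∫ x, p x ^ (1 + α)) ^ (α / (1 + α)) *
          (∫ x, q x ^ (1 + α)) ^ (1 / (1 + α))) - Real.log (∫ x, p x ^ α * q x)) = 0 ↔
        p =ᵐ[volume] q) := by
  have hr : 0 < 1 + α := by linarith
  have hA := integral_rpow_pos_of_integral_eq_one hr.ne' hpnn hpdens hpint
  have hB := integral_rpow_pos_of_integral_eq_one hr.ne' hqnn hqdens hqint
  have holder := integral_rpow_mul_rpow_le_and_eq_iff (s := α / (1 + α)) (t := 1 / (1 + α))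
    (by positivity) (by positivity) (by field_simp; ring)
    (fun x => Real.rpow_nonneg (hpnn x) (1 + α)) (fun x => Real.rpow_nonneg (hqnn x) (1 + α))
    hpint hqint hA hB
  have hpow : ∀ x, (p x ^ (1 + α)) ^ (α / (1 + α)) * (q x ^ (1 + α)) ^ (1 / (1 + α))
      = p x ^ α * q x := fun x => by
    rw [← Real.rpow_mul (hpnn x), ← Real.rpow_mul (hqnn x), mul_div_cancel₀ _ hr.ne',
      mul_div_cancel₀ _ hr.ne', Real.rpow_one]
  simp only [hpow, ae_eq_iff_ae_rpow_div_integral_eq hr.ne' hpnn hqnn hpdens hqdens hpint hqint]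
    at holder
  have hC : 0 < (∫ x, p x ^ (1 + α)) ^ (α / (1 + α)) * (∫ x, q x ^ (1 + α)) ^ (1 / (1 + α)) := by
    positivity
  refine ⟨mul_nonneg (by positivity) (sub_nonneg.2 (Real.log_le_log hpqpos holder.1)), ?_⟩
  rw [← holder.2, mul_eq_zero_iff_left (by positivity), sub_eq_zero,
    Real.log_injOn_pos.eq_iff hC hpqpos, eq_comm]
end

section
/- Let Q be a probability measure on ℝ^d with density q with respect to Lebesgue measure λ, let P be a probability measure with density p, and suppose that for some β > 0 the functions p^β, q^β and ln p, ln q are Q-integrable and p^β, q^β are P-integrable, with p, q positive almost everywhere. Then, as α decreases to 0, the pseudodistance R_α(P,Q) = (1/(1+α)) ln(∫ p^α dP) + (1/(α(1+α))) ln(∫ q^α dQ) − (1/α) ln(∫ p^α dQ) converges to the Kullback–Leibler-type limit R₀(P,Q) = ∫ ln q dQ − ∫ ln p dQ. -/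
open MeasureTheory Filter

theorem Real.abs_rpow_sub_one_div_le {t α β : ℝ} (ht : 0 < t) (hα : 0 < α) (hαβ : α ≤ β) :
    |(t ^ α - 1) / α| ≤ |Real.log t| + t ^ β / β := by
  have hβ : 0 < β := hα.trans_le hαβ
  have hpow : 0 < t ^ β / β := by positivity
  have lower : Real.log t ≤ (t ^ α - 1) / α := by
    rw [le_div_iff₀ hα]
    have h := Real.log_le_sub_one_of_pos (Real.rpow_pos_of_pos ht α)
    rw [Real.log_rpow ht] at h
    linarith
  have upper : (t ^ α - 1) / α ≤ t ^ β / β := by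
    have h := one_add_mul_self_le_rpow_one_add (s := t ^ α - 1) (p := β / α)
      (by linarith [Real.rpow_pos_of_pos ht α]) ((one_le_div hα).2 hαβ)
    rw [add_sub_cancel, ← Real.rpow_mul ht.le, mul_div_cancel₀ _ hα.ne'] at h
    rw [le_div_iff₀ hβ]
    calc (t ^ α - 1) / α * β = β / α * (t ^ α - 1) := by ring
      _ ≤ t ^ β := by linarith
  rw [abs_le]
  exact ⟨by linarith [neg_abs_le (Real.log t)], by linarith [abs_nonneg (Real.log t)]⟩

theorem Real.rpow_le_one_add_rpow {t α β : ℝ} (ht : 0 < t) (hα : 0 ≤ α) (hαβ : α ≤ β) :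
    t ^ α ≤ 1 + t ^ β := by
  rcases le_total t 1 with h1 | h1
  · linarith [Real.rpow_le_one ht.le h1 hα, Real.rpow_pos_of_pos ht β]
  · linarith [Real.rpow_le_rpow_of_exponent_le h1 hαβ]

section RpowMoments

variable {X : Type*} [MeasurableSpace X] {μ : Measure X} {f w : X → ℝ} {β : ℝ}

theorem integrable_rpow_mul_of_le (hf : Measurable f) (hfpos : ∀ᵐ x ∂μ, 0 < f x)
    (hw : Integrable w μ) (hfw : Integrable (fun x => f x ^ β * w x) μ)
    {α : ℝ} (hα : 0 ≤ α) (hαβ : α ≤ β) : Integrable (fun x => f x ^ α * w x) μ := by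
  refine (hw.norm.add hfw.norm).mono'
    ((hf.pow_const α).aestronglyMeasurable.mul hw.aestronglyMeasurable) ?_
  filter_upwards [hfpos] with x hx
  have h := Real.rpow_le_one_add_rpow hx hα hαβ
  simp only [Pi.add_apply, norm_mul, Real.norm_of_nonneg (Real.rpow_nonneg hx.le _)]
  nlinarith [mul_le_mul_of_nonneg_right h (norm_nonneg (w x))]

theorem tendsto_integral_rpow_mul (hf : Measurable f) (hfpos : ∀ᵐ x ∂μ, 0 < f x)
    (hw : Integrable w μ) (hβ : 0 < β) (hfw : Integrable (fun x => f x ^ β * w x) μ) :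
    Tendsto (fun α : ℝ => ∫ x, f x ^ α * w x ∂μ) (nhdsWithin 0 (Set.Ioi 0))
      (nhds (∫ x, w x ∂μ)) := by
  refine tendsto_integral_filter_of_dominated_convergence (fun x => ‖w x‖ + ‖f x ^ β * w x‖)
    (Eventually.of_forall fun α =>
      (hf.pow_const α).aestronglyMeasurable.mul hw.aestronglyMeasurable) ?_
    (hw.norm.add hfw.norm) ?_
  · filter_upwards [Ioc_mem_nhdsGT hβ] with α hα
    filter_upwards [hfpos] with x hx
    have h := Real.rpow_le_one_add_rpow hx hα.1.le hα.2
    simp only [norm_mul, Real.norm_of_nonneg (Real.rpow_nonneg hx.le _)]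
    nlinarith [mul_le_mul_of_nonneg_right h (norm_nonneg (w x))]
  · filter_upwards [hfpos] with x hx
    have h := (Real.hasStrictDerivAt_const_rpow hx 0).hasDerivAt.continuousAt.tendsto
    simpa using (h.mono_left nhdsWithin_le_nhds).mul_const (w x)

theorem hasDerivWithinAt_integral_rpow_mul (hf : Measurable f) (hfpos : ∀ᵐ x ∂μ, 0 < f x)
    (hw : Integrable w μ) (hβ : 0 < β) (hfw : Integrable (fun x => f x ^ β * w x) μ)
    (hlog : Integrable (fun x => Real.log (f x) * w x) μ) :
    HasDerivWithinAt (fun α : ℝ => ∫ x, f x ^ α * w x ∂μ)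
      (∫ x, Real.log (f x) * w x ∂μ) (Set.Ioi 0) 0 := by
  rw [hasDerivWithinAt_iff_tendsto_slope' Set.self_notMem_Ioi]
  have key : Tendsto (fun α : ℝ => ∫ x, (f x ^ α - 1) / α * w x ∂μ) (nhdsWithin 0 (Set.Ioi 0))
      (nhds (∫ x, Real.log (f x) * w x ∂μ)) := by
    refine tendsto_integral_filter_of_dominated_convergence
      (fun x => ‖Real.log (f x) * w x‖ + ‖f x ^ β * w x‖ / β)
      (Eventually.of_forall fun α =>
        (((hf.pow_const α).sub_const 1).div_const α).aestronglyMeasurable.mul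
          hw.aestronglyMeasurable) ?_ (hlog.norm.add (hfw.norm.div_const β)) ?_
    · filter_upwards [Ioc_mem_nhdsGT hβ] with α hα
      filter_upwards [hfpos] with x hx
      have h := mul_le_mul_of_nonneg_right (Real.abs_rpow_sub_one_div_le hx hα.1 hα.2)
        (norm_nonneg (w x))
      rw [norm_mul, norm_mul, norm_mul, Real.norm_of_nonneg (Real.rpow_nonneg hx.le β)]
      calc _ ≤ _ := h
        _ = _ := by rw [Real.norm_eq_abs (Real.log _)]; ring
    · filter_upwards [hfpos] with x hx
      have h := (Real.hasStrictDerivAt_const_rpow hx 0).hasDerivAt.hasDerivWithinAt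
        (s := Set.Ioi 0)
      rw [hasDerivWithinAt_iff_tendsto_slope' Set.self_notMem_Ioi] at h
      simpa [slope_fun_def_field] using h.mul_const (w x)
  refine key.congr' ?_
  filter_upwards [Ioc_mem_nhdsGT hβ] with α hα
  rw [slope_def_field, ← integral_sub
    (integrable_rpow_mul_of_le hf hfpos hw hfw hα.1.le hα.2) (by simpa using hw),
    ← integral_div]
  congr 1 with x
  simp only [Real.rpow_zero, sub_zero]
  ring

theorem tendsto_log_integral_rpow_mul_div (hf : Measurable f) (hfpos : ∀ᵐ x ∂μ, 0 < f x)
    (hw : Integrable w μ) (hw1 : ∫ x, w x ∂μ = 1) (hβ : 0 < β)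
    (hfw : Integrable (fun x => f x ^ β * w x) μ)
    (hlog : Integrable (fun x => Real.log (f x) * w x) μ) :
    Tendsto (fun α : ℝ => 1 / α * Real.log (∫ x, f x ^ α * w x ∂μ)) (nhdsWithin 0 (Set.Ioi 0))
      (nhds (∫ x, Real.log (f x) * w x ∂μ)) := by
  have h := (hasDerivWithinAt_integral_rpow_mul hf hfpos hw hβ hfw hlog).log (by simp [hw1])
  rw [hasDerivWithinAt_iff_tendsto_slope' Set.self_notMem_Ioi] at h
  simpa [slope_fun_def_field, hw1, div_eq_inv_mul] using h

end RpowMoments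

/-- As `α ↓ 0`, the pseudodistance
`R_α(P,Q) = (1/(1+α)) ln ∫ p^α dP + (1/(α(1+α))) ln ∫ q^α dQ − (1/α) ln ∫ p^α dQ`
converges to the Kullback–Leibler-type limit `R₀(P,Q) = ∫ ln q dQ − ∫ ln p dQ`.
Here `P` and `Q` have densities `p` and `q` w.r.t. Lebesgue measure, so that
`∫ f dP = ∫ f·p dλ` and `∫ f dQ = ∫ f·q dλ`. -/
theorem Ralpha_tendsto_KullbackLeibler {d : ℕ}
    (p q : (Fin d → ℝ) → ℝ)
    (hpmeas : Measurable p) (hqmeas : Measurable q)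
    (hpnn : ∀ x, 0 ≤ p x) (hqnn : ∀ x, 0 ≤ q x)
    (hppos : ∀ᵐ x, 0 < p x) (hqpos : ∀ᵐ x, 0 < q x)
    (hpdens : ∫ x, p x = 1) (hqdens : ∫ x, q x = 1)
    (β : ℝ) (hβ : 0 < β)
    (hpβQ : Integrable (fun x => p x ^ β * q x))
    (hqβQ : Integrable (fun x => q x ^ β * q x))
    (hlogpQ : Integrable (fun x => Real.log (p x) * q x))
    (hlogqQ : Integrable (fun x => Real.log (q x) * q x))
    (hpβP : Integrable (fun x => p x ^ β * p x))
    (hqβP : Integrable (fun x => q x ^ β * p x)) :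
    Tendsto (fun α : ℝ =>
        (1 / (1 + α)) * Real.log (∫ x, p x ^ α * p x) +
          (1 / (α * (1 + α))) * Real.log (∫ x, q x ^ α * q x) -
          (1 / α) * Real.log (∫ x, p x ^ α * q x))
      (nhdsWithin 0 (Set.Ioi 0))
      (nhds ((∫ x, Real.log (q x) * q x) - ∫ x, Real.log (p x) * q x)) := by
  have hp : Integrable p := .of_integral_ne_zero (by simp [hpdens])
  have hq : Integrable q := .of_integral_ne_zero (by simp [hqdens])
  have hinv : Tendsto (fun α : ℝ => 1 / (1 + α)) (nhdsWithin 0 (Set.Ioi 0)) (nhds 1) := by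
    have h : ContinuousAt (fun α : ℝ => 1 / (1 + α)) 0 := by fun_prop (disch := norm_num)
    simpa using h.tendsto.mono_left nhdsWithin_le_nhds
  have hP : Tendsto (fun α : ℝ => Real.log (∫ x, p x ^ α * p x)) (nhdsWithin 0 (Set.Ioi 0))
      (nhds 0) := by
    simpa [hpdens] using
      (tendsto_integral_rpow_mul hpmeas hppos hp hβ hpβP).log (by simp [hpdens])
  have hQ := tendsto_log_integral_rpow_mul_div hqmeas hqpos hq hqdens hβ hqβQ hlogqQ
  have hPQ := tendsto_log_integral_rpow_mul_div hpmeas hppos hq hqdens hβ hpβQ hlogpQ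
  have h := ((hinv.mul hP).add (hinv.mul hQ)).sub hPQ
  rw [mul_zero, one_mul, zero_add] at h
  refine h.congr fun α => ?_
  rw [← mul_assoc (1 / (1 + α)), one_div_mul_one_div, mul_comm (1 + α) α]
end

section
/- Let Q be a probability measure on ℝ^d and let p be a measurable function that is positive Q-almost everywhere. If for some β > 0 the function p^β is Q-integrable and ln p is Q-integrable, then lim_{α → 0⁺} (1/α) · ln( ∫ p^α dQ ) = ∫ ln p dQ. -/
open MeasureTheory Filter
open scoped Topology

/-- The Box–Cox transform `α⁻¹ (x ^ α - 1)` dominates the logarithm. -/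
lemma Real.log_le_inv_mul_rpow_sub_one {x α : ℝ} (hx : 0 < x) (hα : 0 < α) :
    Real.log x ≤ α⁻¹ * (x ^ α - 1) := by
  rw [le_inv_mul_iff₀ hα, ← Real.log_rpow hx]
  exact Real.log_le_sub_one_of_pos (Real.rpow_pos_of_pos hx α)

/-- The Box–Cox transform `α⁻¹ (x ^ α - 1)` is monotone in the exponent `α > 0`. -/
lemma Real.inv_mul_rpow_sub_one_le {x α β : ℝ} (hx : 0 < x) (hα : 0 < α) (hαβ : α ≤ β) :
    α⁻¹ * (x ^ α - 1) ≤ β⁻¹ * (x ^ β - 1) := by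
  have hβ : 0 < β := hα.trans_le hαβ
  have hbernoulli := one_add_mul_self_le_rpow_one_add (s := x ^ α - 1) (p := β / α)
    (by linarith [Real.rpow_pos_of_pos hx α]) ((one_le_div hα).2 hαβ)
  rw [add_sub_cancel, ← Real.rpow_mul hx.le, mul_div_cancel₀ _ hα.ne'] at hbernoulli
  rw [le_inv_mul_iff₀ hβ, ← mul_assoc, ← div_eq_mul_inv]
  linarith

section IntegralRpow

variable {Ω : Type*} [MeasurableSpace Ω] {μ : Measure Ω} {f : Ω → ℝ} {α β : ℝ}

lemma ae_norm_inv_mul_rpow_sub_one_le (hpos : ∀ᵐ x ∂μ, 0 < f x) (hα : 0 < α) (hαβ : α ≤ β) :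
    ∀ᵐ x ∂μ, ‖α⁻¹ * (f x ^ α - 1)‖ ≤ |Real.log (f x)| + |β⁻¹ * (f x ^ β - 1)| := by
  filter_upwards [hpos] with x hx
  rw [Real.norm_eq_abs, abs_le]
  constructor
  · linarith [Real.log_le_inv_mul_rpow_sub_one hx hα, neg_abs_le (Real.log (f x)),
      abs_nonneg (β⁻¹ * (f x ^ β - 1))]
  · linarith [Real.inv_mul_rpow_sub_one_le hx hα hαβ, le_abs_self (β⁻¹ * (f x ^ β - 1)),
      abs_nonneg (Real.log (f x))]

variable [IsProbabilityMeasure μ]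

lemma integrable_abs_log_add_abs_inv_mul_rpow_sub_one
    (hfβ : Integrable (fun x => f x ^ β) μ) (hlog : Integrable (fun x => Real.log (f x)) μ) :
    Integrable (fun x => |Real.log (f x)| + |β⁻¹ * (f x ^ β - 1)|) μ :=
  hlog.abs.add ((hfβ.sub (integrable_const 1)).const_mul β⁻¹).abs

lemma integrable_rpow_of_le (hf : AEMeasurable f μ) (hpos : ∀ᵐ x ∂μ, 0 < f x)
    (hfβ : Integrable (fun x => f x ^ β) μ) (hlog : Integrable (fun x => Real.log (f x)) μ)
    (hα : 0 < α) (hαβ : α ≤ β) : Integrable (fun x => f x ^ α) μ := by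
  have hint : Integrable (fun x => α⁻¹ * (f x ^ α - 1)) μ :=
    (integrable_abs_log_add_abs_inv_mul_rpow_sub_one hfβ hlog).mono'
      (((hf.pow_const α).sub_const 1).const_mul α⁻¹).aestronglyMeasurable
      (ae_norm_inv_mul_rpow_sub_one_le hpos hα hαβ)
  refine ((hint.const_mul α).add (integrable_const 1)).congr (.of_forall fun x => ?_)
  simp [mul_inv_cancel_left₀ hα.ne']

/-- The right derivative at `0` of `α ↦ ∫ f ^ α ∂μ` is `∫ log f ∂μ`. -/
lemma hasDerivWithinAt_integral_rpow (hf : AEMeasurable f μ) (hpos : ∀ᵐ x ∂μ, 0 < f x)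
    (hβ : 0 < β) (hfβ : Integrable (fun x => f x ^ β) μ)
    (hlog : Integrable (fun x => Real.log (f x)) μ) :
    HasDerivWithinAt (fun α : ℝ => ∫ x, f x ^ α ∂μ) (∫ x, Real.log (f x) ∂μ) (Set.Ioi 0) 0 := by
  rw [hasDerivWithinAt_iff_tendsto_slope' Set.self_notMem_Ioi]
  have hmem : ∀ᶠ α : ℝ in 𝓝[>] 0, α ∈ Set.Ioc 0 β := Ioc_mem_nhdsGT hβ
  have hlim : Tendsto (fun α : ℝ => ∫ x, α⁻¹ * (f x ^ α - 1) ∂μ) (𝓝[>] 0)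
      (𝓝 (∫ x, Real.log (f x) ∂μ)) := by
    refine tendsto_integral_filter_of_dominated_convergence _
      (.of_forall fun α => (((hf.pow_const α).sub_const 1).const_mul α⁻¹).aestronglyMeasurable)
      ?_ (integrable_abs_log_add_abs_inv_mul_rpow_sub_one hfβ hlog) ?_
    · filter_upwards [hmem] with α hα
      exact ae_norm_inv_mul_rpow_sub_one_le hpos hα.1 hα.2
    · filter_upwards [hpos] with x hx
      exact tendsto_rpow_sub_one_log hx
  refine hlim.congr' ?_
  filter_upwards [hmem] with α hα
  rw [integral_const_mul,
    integral_sub (integrable_rpow_of_le hf hpos hfβ hlog hα.1 hα.2) (integrable_const 1)]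
  simp [slope_def_field, div_eq_inv_mul]

end IntegralRpow

/-- If `p > 0` `Q`-a.e., `p^β` is `Q`-integrable for some `β > 0` and `ln p` is `Q`-integrable,
then `(1/α) ln ∫ p^α dQ → ∫ ln p dQ` as `α → 0⁺`. -/
theorem tendsto_inv_mul_log_integral_rpow {d : ℕ}
    (Q : Measure (Fin d → ℝ)) [IsProbabilityMeasure Q]
    (p : (Fin d → ℝ) → ℝ) (hpmeas : Measurable p) (hpnn : ∀ x, 0 ≤ p x)
    (hppos : ∀ᵐ x ∂Q, 0 < p x)
    (β : ℝ) (hβ : 0 < β)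
    (hpβ : Integrable (fun x => p x ^ β) Q)
    (hlogp : Integrable (fun x => Real.log (p x)) Q) :
    Tendsto (fun α : ℝ => (1 / α) * Real.log (∫ x, p x ^ α ∂Q))
      (nhdsWithin 0 (Set.Ioi 0)) (nhds (∫ x, Real.log (p x) ∂Q)) := by
  have hderiv := (hasDerivWithinAt_integral_rpow hpmeas.aemeasurable hppos hβ hpβ hlogp).log
    (by simp)
  rw [hasDerivWithinAt_iff_tendsto_slope' Set.self_notMem_Ioi] at hderiv
  simpa [slope_fun_def] using hderiv
end

section
/- Let α > 0, let p_θ (θ ∈ Θ) be probability densities on ℝ^d with respect to Lebesgue measure λ with 0 < ∫ p_θ^{1+α} dλ < ∞, and let T : ℝ^d → ℝ^d be the invertible affine map T x = A x + b with A an invertible d×d real matrix. Define the transformed densities p̃_θ(y) = p_θ(T^{-1} y) · |det A|^{-1}. Then for every θ and every x ∈ ℝ^d, ( ∫ p̃_θ^{1+α} dλ )^{-α/(1+α)} · p̃_θ(T x)^α = |det A|^{-α/(1+α)} · ( ∫ p_θ^{1+α} dλ )^{-α/(1+α)} · p_θ(x)^α. Consequently, for any sample X₁,…,X_n, the transformed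 criterion θ ↦ C̃_α(θ)^{-1} (1/n) Σ_i p̃_θ^α(T X_i) is a constant positive multiple (independent of θ) of the original criterion θ ↦ C_α(θ)^{-1} (1/n) Σ_i p_θ^α(X_i), so the two criteria have the same maximizers: the minimum R_α-estimators are equivariant under invertible affine transformations of the observations. -/
open MeasureTheory

/-- Change of variables for the affine map `y ↦ A (y - b)`. -/
theorem integral_comp_mulVec_sub {ι : Type*} [Fintype ι] [DecidableEq ι]
    {E : Type*} [NormedAddCommGroup E] [NormedSpace ℝ E]
    {A : Matrix ι ι ℝ} (hA : A.det ≠ 0) (b : ι → ℝ) (f : (ι → ℝ) → E) :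
    ∫ y, f (A.mulVec (y - b)) = |A.det|⁻¹ • ∫ y, f y := by
  have hemb : MeasurableEmbedding (Matrix.toLin' A) :=
    (LinearEquiv.toContinuousLinearEquiv
      (Matrix.toLinearEquiv' A (A.invertibleOfIsUnitDet hA.isUnit))).toHomeomorph.measurableEmbedding
  calc ∫ y, f (A.mulVec (y - b)) = ∫ y, f (Matrix.toLin' A y) := by
        simpa using integral_sub_right_eq_self (fun y => f (A.mulVec y)) b
    _ = ∫ y, f y ∂(Measure.map (Matrix.toLin' A) volume) := (hemb.integral_map f).symm
    _ = |A.det|⁻¹ • ∫ y, f y := by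
        rw [Real.map_matrix_volume_pi_eq_smul_volume_pi hA, integral_smul_measure,
          ENNReal.toReal_ofReal (abs_nonneg _), abs_inv]

/-- Equivariance of minimum `R_α`-estimators under invertible affine transformations
`T x = A x + b` of the observations.  With transformed densities
`p̃_θ(y) = p_θ(T⁻¹ y)·|det A|⁻¹` one has, pointwise,
`C̃_α(θ)⁻¹ p̃_θ(T x)^α = |det A|^{−α/(1+α)} C_α(θ)⁻¹ p_θ(x)^α`, and hence for any sample the
transformed criterion is a constant positive multiple of the original one, so that both
criteria have the same maximizers. -/
theorem minRalpha_affine_equivariance {d : ℕ} {Θ : Type*} (α : ℝ) (hα : 0 < α)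
    (p : Θ → (Fin d → ℝ) → ℝ)
    (hpmeas : ∀ θ, Measurable (p θ)) (hpnn : ∀ θ y, 0 ≤ p θ y)
    (hpdens : ∀ θ, ∫ y, p θ y = 1)
    (hpint : ∀ θ, Integrable (fun y => p θ y ^ (1 + α)))
    (hppos : ∀ θ, 0 < ∫ y, p θ y ^ (1 + α))
    (A : Matrix (Fin d) (Fin d) ℝ) (hA : IsUnit A.det) (b : Fin d → ℝ)
    (pt : Θ → (Fin d → ℝ) → ℝ)
    (hpt : ∀ θ y, pt θ y = p θ (A⁻¹.mulVec (y - b)) * |A.det|⁻¹)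
    (C Ct : Θ → ℝ)
    (hC : ∀ θ, C θ = (∫ y, p θ y ^ (1 + α)) ^ (α / (1 + α)))
    (hCt : ∀ θ, Ct θ = (∫ y, pt θ y ^ (1 + α)) ^ (α / (1 + α))) :
    (∀ θ (x : Fin d → ℝ),
        (Ct θ)⁻¹ * pt θ (A.mulVec x + b) ^ α =
          |A.det| ^ (-(α / (1 + α))) * ((C θ)⁻¹ * p θ x ^ α)) ∧
    ∀ (n : ℕ) (X : Fin n → (Fin d → ℝ)), ∃ c : ℝ, 0 < c ∧
      (∀ θ, (Ct θ)⁻¹ * ((1 / n : ℝ) * ∑ i, pt θ (A.mulVec (X i) + b) ^ α) =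
          c * ((C θ)⁻¹ * ((1 / n : ℝ) * ∑ i, p θ (X i) ^ α))) ∧
      ∀ θ₀ : Θ,
        (∀ θ, (C θ)⁻¹ * ((1 / n : ℝ) * ∑ i, p θ (X i) ^ α) ≤
            (C θ₀)⁻¹ * ((1 / n : ℝ) * ∑ i, p θ₀ (X i) ^ α)) ↔
        (∀ θ, (Ct θ)⁻¹ * ((1 / n : ℝ) * ∑ i, pt θ (A.mulVec (X i) + b) ^ α) ≤
            (Ct θ₀)⁻¹ * ((1 / n : ℝ) * ∑ i, pt θ₀ (A.mulVec (X i) + b) ^ α)) := by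
  have hD : 0 < |A.det| := abs_pos.mpr hA.ne_zero
  have hα' : 1 + α ≠ 0 := by positivity
  have hdet : A⁻¹.det = A.det⁻¹ := by
    rw [Matrix.det_nonsing_inv, Ring.inverse_eq_inv']
  have hint : ∀ θ, ∫ y, pt θ y ^ (1 + α) = |A.det| ^ (-α) * ∫ y, p θ y ^ (1 + α) := by
    intro θ
    have hpow : ∀ y, pt θ y ^ (1 + α) =
        p θ (A⁻¹.mulVec (y - b)) ^ (1 + α) * |A.det| ^ (-(1 + α)) := fun y => by
      rw [hpt, Real.mul_rpow (hpnn _ _) (inv_nonneg.mpr hD.le), Real.inv_rpow hD.le,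
        Real.rpow_neg hD.le]
    have hinv : A⁻¹.det ≠ 0 := hdet ▸ inv_ne_zero hA.ne_zero
    simp_rw [hpow]
    rw [integral_mul_const, integral_comp_mulVec_sub hinv b (fun y => p θ y ^ (1 + α)), hdet,
      abs_inv, inv_inv, smul_eq_mul, mul_right_comm, ← Real.rpow_one_add' hD.le (by simpa using hα.ne')]
    congr 2
    ring
  have hpoint : ∀ θ (x : Fin d → ℝ), (Ct θ)⁻¹ * pt θ (A.mulVec x + b) ^ α =
      |A.det| ^ (-(α / (1 + α))) * ((C θ)⁻¹ * p θ x ^ α) := by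
    intro θ x
    have hx : A⁻¹.mulVec (A.mulVec x + b - b) = x := by
      rw [add_sub_cancel_right, Matrix.mulVec_mulVec, Matrix.nonsing_inv_mul A hA,
        Matrix.one_mulVec]
    have hexp : |A.det| ^ (-(α / (1 + α))) =
        (|A.det| ^ (-α * (α / (1 + α))))⁻¹ * (|A.det| ^ α)⁻¹ := by
      rw [← Real.rpow_neg hD.le, ← Real.rpow_neg hD.le, ← Real.rpow_add hD]
      congr 1
      field_simp
      ring
    rw [hCt, hint, Real.mul_rpow (Real.rpow_nonneg hD.le _) (hppos θ).le, ← Real.rpow_mul hD.le,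
      ← hC, hpt, hx, Real.mul_rpow (hpnn _ _) (inv_nonneg.mpr hD.le), Real.inv_rpow hD.le, hexp,
      mul_inv]
    ring
  have hc : 0 < |A.det| ^ (-(α / (1 + α))) := Real.rpow_pos_of_pos hD _
  refine ⟨hpoint, fun n X => ⟨_, hc, ?_⟩⟩
  have hcrit : ∀ θ, (Ct θ)⁻¹ * ((1 / n : ℝ) * ∑ i, pt θ (A.mulVec (X i) + b) ^ α) =
      |A.det| ^ (-(α / (1 + α))) * ((C θ)⁻¹ * ((1 / n : ℝ) * ∑ i, p θ (X i) ^ α)) := by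
    intro θ
    rw [mul_left_comm, Finset.mul_sum, Finset.sum_congr rfl fun i _ => hpoint θ (X i),
      ← Finset.mul_sum, ← Finset.mul_sum]
    ring
  refine ⟨hcrit, fun θ₀ => ?_⟩
  simp only [hcrit, mul_le_mul_iff_right₀ hc]
end

section
/- Let α > 0 and let {p_θ : θ ∈ Θ} be probability densities on ℝ^d with respect to Lebesgue measure λ satisfying 0 < ∫ p_θ^{1+α} dλ < ∞ and 0 < ∫ p_θ^α p_{θ₀} dλ < ∞ for all θ, θ₀ ∈ Θ, and assume the model is identifiable in the sense that p_θ = p_{θ'} λ-a.e. implies θ = θ'. Then for every θ₀ ∈ Θ, the parameter θ₀ is the unique maximizer over Θ of the map θ ↦ ( ∫ p_θ^α dP_{θ₀} ) / C_α(θ), where C_α(θ) = ( ∫ p_θ^{1+α} dλ )^{α/(1+α)}; that is, the functional T_α(Q) = argsup_θ (∫ p_θ^α dQ)/C_α(θ) is Fisher consistent: T_α(P_{θ₀}) = θ₀. -/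
open MeasureTheory

/-- Strict Young inequality for the exponents `(1 + α) / α` and `1 + α`. -/
lemma rpow_mul_lt_of_ne {α x y : ℝ} (hα : 0 < α) (hx : 0 ≤ x) (hy : 0 ≤ y) (hxy : x ≠ y) :
    x ^ α * y < (α * x ^ (1 + α) + y ^ (1 + α)) / (1 + α) := by
  have h1 : 0 < 1 + α := by linarith
  rw [lt_div_iff₀ h1]
  rcases hx.eq_or_lt with rfl | hx
  · rw [Real.zero_rpow hα.ne', Real.zero_rpow h1.ne']
    have := Real.rpow_pos_of_pos (lt_of_le_of_ne hy hxy) (1 + α)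
    linarith
  · have hne : y / x - 1 ≠ 0 := by
      rw [sub_ne_zero, Ne, div_eq_one_iff_eq hx.ne']
      exact hxy.symm
    have hb := one_add_mul_self_lt_rpow_one_add (s := y / x - 1)
      (by have := div_nonneg hy hx.le; linarith) hne (p := 1 + α) (by linarith)
    rw [add_sub_cancel, Real.div_rpow hy hx.le,
      lt_div_iff₀ (Real.rpow_pos_of_pos hx _)] at hb
    have hxa : x ^ (1 + α) = x ^ α * x := by rw [add_comm, Real.rpow_add_one hx.ne']
    have he : (1 + (1 + α) * (y / x - 1)) * (x ^ α * x)
        = (1 + α) * (x ^ α * y) - α * (x ^ α * x) := by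
      field_simp
      ring
    rw [hxa] at hb ⊢
    linarith

lemma rpow_mul_self_eq {α x : ℝ} (hα : 0 < α) (hx : 0 ≤ x) : x ^ α * x = x ^ (1 + α) := by
  rw [add_comm, Real.rpow_add_of_nonneg hx hα.le zero_le_one, Real.rpow_one]

lemma rpow_mul_le_young {α x y : ℝ} (hα : 0 < α) (hx : 0 ≤ x) (hy : 0 ≤ y) :
    x ^ α * y ≤ (α * x ^ (1 + α) + y ^ (1 + α)) / (1 + α) := by
  rcases eq_or_ne x y with rfl | hxy
  · rw [rpow_mul_self_eq hα hx]
    apply le_of_eq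
    field_simp
    ring
  · exact (rpow_mul_lt_of_ne hα hx hy hxy).le

section Holder

variable {X : Type*} [MeasurableSpace X] {μ : Measure X} {α : ℝ} {f g : X → ℝ}

/-- Hölder's inequality for normalized functions, with its equality case. -/
lemma integral_rpow_mul_le_one (hα : 0 < α) (hf : ∀ x, 0 ≤ f x) (hg : ∀ x, 0 ≤ g x)
    (hfi : Integrable (fun x => f x ^ (1 + α)) μ) (hgi : Integrable (fun x => g x ^ (1 + α)) μ)
    (hfg : Integrable (fun x => f x ^ α * g x) μ)
    (hf1 : ∫ x, f x ^ (1 + α) ∂μ = 1) (hg1 : ∫ x, g x ^ (1 + α) ∂μ = 1) :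
    ∫ x, f x ^ α * g x ∂μ ≤ 1 ∧ (∫ x, f x ^ α * g x ∂μ = 1 → f =ᵐ[μ] g) := by
  have hi : Integrable (fun x => (α * f x ^ (1 + α) + g x ^ (1 + α)) / (1 + α)) μ :=
    ((hfi.const_mul α).add hgi).div_const _
  have h1 : ∫ x, (α * f x ^ (1 + α) + g x ^ (1 + α)) / (1 + α) ∂μ = 1 := by
    rw [integral_div, integral_add (hfi.const_mul α) hgi, integral_const_mul, hf1, hg1,
      mul_one, add_comm, div_self (by linarith)]
  have hle : (fun x => f x ^ α * g x) ≤
      fun x => (α * f x ^ (1 + α) + g x ^ (1 + α)) / (1 + α) :=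
    fun x => rpow_mul_le_young hα (hf x) (hg x)
  refine ⟨h1 ▸ integral_mono hfg hi hle, fun h => ?_⟩
  have hae := (integral_eq_iff_of_ae_le hfg hi (Filter.Eventually.of_forall hle)).1 (h.trans h1.symm)
  filter_upwards [hae] with x hx
  by_contra hne
  exact (rpow_mul_lt_of_ne hα (hf x) (hg x) hne).ne hx

/-- Hölder's inequality in ratio form; equality forces proportionality. -/
lemma integral_rpow_mul_div_le (hα : 0 < α) (hf : ∀ x, 0 ≤ f x) (hg : ∀ x, 0 ≤ g x)
    (hfi : Integrable (fun x => f x ^ (1 + α)) μ) (hgi : Integrable (fun x => g x ^ (1 + α)) μ)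
    (hfg : Integrable (fun x => f x ^ α * g x) μ)
    (hf0 : 0 < ∫ x, f x ^ (1 + α) ∂μ) (hg0 : 0 < ∫ x, g x ^ (1 + α) ∂μ) :
    (∫ x, f x ^ α * g x ∂μ) / (∫ x, f x ^ (1 + α) ∂μ) ^ (α / (1 + α)) ≤
        (∫ x, g x ^ α * g x ∂μ) / (∫ x, g x ^ (1 + α) ∂μ) ^ (α / (1 + α)) ∧
      ((∫ x, f x ^ α * g x ∂μ) / (∫ x, f x ^ (1 + α) ∂μ) ^ (α / (1 + α)) =
        (∫ x, g x ^ α * g x ∂μ) / (∫ x, g x ^ (1 + α) ∂μ) ^ (α / (1 + α)) →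
          ∃ c : ℝ, f =ᵐ[μ] fun x => c * g x) := by
  have h1 : 0 < 1 + α := by linarith
  have root (A : ℝ) (hA : 0 < A) : ∃ a, 0 < a ∧ A = a ^ (1 + α) :=
    ⟨A ^ (1 + α)⁻¹, Real.rpow_pos_of_pos hA _, (Real.rpow_inv_rpow hA.le h1.ne').symm⟩
  obtain ⟨a, ha, hA⟩ := root _ hf0
  obtain ⟨b, hb, hB⟩ := root _ hg0
  have hpow (c : ℝ) (hc : 0 < c) : (c ^ (1 + α)) ^ (α / (1 + α)) = c ^ α := by
    rw [← Real.rpow_mul hc.le, mul_div_cancel₀ _ h1.ne']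
  have hfs : (fun x => (f x / a) ^ (1 + α)) = fun x => f x ^ (1 + α) / a ^ (1 + α) :=
    funext fun x => Real.div_rpow (hf x) ha.le _
  have hgs : (fun x => (g x / b) ^ (1 + α)) = fun x => g x ^ (1 + α) / b ^ (1 + α) :=
    funext fun x => Real.div_rpow (hg x) hb.le _
  have hfgs : (fun x => (f x / a) ^ α * (g x / b)) =
      fun x => f x ^ α * g x / (a ^ α * b) := by
    funext x
    rw [Real.div_rpow (hf x) ha.le, div_mul_div_comm]
  have hapos : 0 < a ^ α := Real.rpow_pos_of_pos ha _
  have hgg : (∫ x, g x ^ α * g x ∂μ) / (b ^ (1 + α)) ^ (α / (1 + α)) = b := by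
    simp_rw [rpow_mul_self_eq hα (hg _)]
    rw [hpow b hb, hB, ← rpow_mul_self_eq hα hb.le,
      mul_div_cancel_left₀ _ (Real.rpow_pos_of_pos hb _).ne']
  obtain ⟨hle, heq⟩ := integral_rpow_mul_le_one (μ := μ) (f := fun x => f x / a)
    (g := fun x => g x / b) hα (fun x => div_nonneg (hf x) ha.le)
    (fun x => div_nonneg (hg x) hb.le) (hfs ▸ hfi.div_const _) (hgs ▸ hgi.div_const _)
    (hfgs ▸ hfg.div_const _)
    (by rw [hfs, integral_div, hA, div_self (Real.rpow_pos_of_pos ha _).ne'])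
    (by rw [hgs, integral_div, hB, div_self (Real.rpow_pos_of_pos hb _).ne'])
  rw [hfgs, integral_div] at hle heq
  rw [hA, hB, hgg, hpow a ha]
  refine ⟨?_, fun h => ⟨a / b, ?_⟩⟩
  · rw [div_le_one (by positivity)] at hle
    rwa [div_le_iff₀ hapos, mul_comm b]
  · rw [div_eq_iff hapos.ne', mul_comm b] at h
    filter_upwards [heq (by rw [h, div_self (by positivity)])] with x hx
    rw [div_eq_iff ha.ne'] at hx
    rw [hx]
    ring

end Holder

/-- Fisher consistency of the minimum `R_α`-pseudodistance functional: for an identifiable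
family of densities, `θ₀` is the unique maximizer over `Θ` of
`θ ↦ (∫ p_θ^α dP_{θ₀}) / C_α(θ)`, where `C_α(θ) = (∫ p_θ^{1+α} dλ)^{α/(1+α)}` and
`∫ p_θ^α dP_{θ₀} = ∫ p_θ^α p_{θ₀} dλ`. -/
theorem minRalpha_fisher_consistency {d : ℕ} {Θ : Type*} (α : ℝ) (hα : 0 < α)
    (p : Θ → (Fin d → ℝ) → ℝ)
    (hpmeas : ∀ θ, Measurable (p θ)) (hpnn : ∀ θ y, 0 ≤ p θ y)
    (hpdens : ∀ θ, ∫ y, p θ y = 1)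
    (hpint : ∀ θ, Integrable (fun y => p θ y ^ (1 + α)))
    (hppos : ∀ θ, 0 < ∫ y, p θ y ^ (1 + α))
    (hcrossint : ∀ θ θ₀, Integrable (fun y => p θ y ^ α * p θ₀ y))
    (hcrosspos : ∀ θ θ₀, 0 < ∫ y, p θ y ^ α * p θ₀ y)
    (hident : ∀ θ θ', p θ =ᵐ[volume] p θ' → θ = θ')
    (C : Θ → ℝ) (hC : ∀ θ, C θ = (∫ y, p θ y ^ (1 + α)) ^ (α / (1 + α))) :
    ∀ θ₀ θ : Θ,
      ((∫ y, p θ y ^ α * p θ₀ y) / C θ ≤ (∫ y, p θ₀ y ^ α * p θ₀ y) / C θ₀) ∧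
      ((∫ y, p θ y ^ α * p θ₀ y) / C θ = (∫ y, p θ₀ y ^ α * p θ₀ y) / C θ₀ → θ = θ₀) := by
  intro θ₀ θ
  obtain ⟨hle, heq⟩ := integral_rpow_mul_div_le hα (hpnn θ) (hpnn θ₀) (hpint θ) (hpint θ₀)
    (hcrossint θ θ₀) (hppos θ) (hppos θ₀)
  rw [hC, hC]
  refine ⟨hle, fun h => hident _ _ ?_⟩
  obtain ⟨c, hc⟩ := heq h
  have hc1 : c = 1 := by
    have := integral_congr_ae hc
    rw [integral_const_mul, hpdens, hpdens, mul_one] at this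
    exact this.symm
  simpa only [hc1, one_mul] using hc
end

section
/- Consider the scale normal family with known mean m: p_σ(x) = (σ√(2π))^{-1} exp(−(x−m)²/(2σ²)), σ > 0, and let ṗ_σ = ∂p_σ/∂σ. For α > 0 define c_α(σ) = (∫ p_σ^α ṗ_σ dλ)/(∫ p_σ^{α+1} dλ) and M_α(σ) = ∫ p_σ^{α−1} ṗ_σ² dλ − (∫ p_σ^α ṗ_σ dλ)² / ∫ p_σ^{α+1} dλ. Then for every x ∈ ℝ, M_α(σ)^{-1} · [ p_σ^{α−1}(x) ṗ_σ(x) − c_α(σ) p_σ^α(x) ] = (σ(α+1)^{5/2}/2) · [ ((x−m)/σ)² − 1/(α+1) ] · exp( −(α/2)((x−m)/σ)² ); i.e., the influence function of the minimum R_α-estimator of σ equals this explicit expression. -/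
open MeasureTheory Real

/-- Even moments of an unnormalised centred Gaussian. -/
theorem integral_pow_even_mul_exp_neg_mul_sq {b : ℝ} (hb : 0 < b) (n : ℕ) :
    ∫ x : ℝ, x ^ (2 * n) * Real.exp (-b * x ^ 2) =
      b ^ (-((n : ℝ) + 1 / 2)) * Real.Gamma (n + 1 / 2) := by
  have h1 := integral_comp_abs (f := fun x : ℝ => x ^ (2 * n) * Real.exp (-b * x ^ 2))
  have h2 := integral_rpow_mul_exp_neg_mul_rpow (p := 2) (q := (2 * n : ℕ)) (b := b)
    (by norm_num) (by have : (0 : ℝ) ≤ (2 * n : ℕ) := Nat.cast_nonneg _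
                      linarith) hb
  simp only [Real.rpow_natCast, Real.rpow_two] at h2
  simp only [pow_mul, sq_abs] at h1 h2 ⊢
  rw [h1, h2]
  have e : (((2 * n : ℕ) : ℝ) + 1) / 2 = n + 1 / 2 := by push_cast; ring
  rw [neg_div, e]
  ring

theorem integrable_pow_mul_exp_neg_mul_sq {b : ℝ} (hb : 0 < b) (n : ℕ) :
    Integrable fun x : ℝ => x ^ n * Real.exp (-b * x ^ 2) := by
  have h := integrable_rpow_mul_exp_neg_mul_sq hb (s := n)
    (by have : (0 : ℝ) ≤ n := Nat.cast_nonneg _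
        linarith)
  simpa only [Real.rpow_natCast] using h

theorem integral_sq_mul_exp_neg_mul_sq {b : ℝ} (hb : 0 < b) :
    ∫ x : ℝ, x ^ 2 * Real.exp (-b * x ^ 2) = √(π / b) / (2 * b) := by
  have h := integral_pow_even_mul_exp_neg_mul_sq hb 1
  have hG := Real.Gamma_nat_add_half 1
  simp only [mul_one] at h
  rw [h, hG, Real.rpow_neg hb.le, Real.rpow_add hb, Real.rpow_natCast, ← Real.sqrt_eq_rpow,
    Real.sqrt_div pi_pos.le]
  have := Real.sqrt_pos.2 hb
  norm_num [Nat.doubleFactorial]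
  field_simp

theorem integral_pow_four_mul_exp_neg_mul_sq {b : ℝ} (hb : 0 < b) :
    ∫ x : ℝ, x ^ 4 * Real.exp (-b * x ^ 2) = 3 * √(π / b) / (4 * b ^ 2) := by
  have h := integral_pow_even_mul_exp_neg_mul_sq hb 2
  have hG := Real.Gamma_nat_add_half 2
  norm_num only at h
  norm_num only [Nat.cast_ofNat] at hG
  rw [h, hG, show (-(5 / 2) : ℝ) = -((2 : ℕ) + 1 / 2) by norm_num,
    Real.rpow_neg hb.le, Real.rpow_add hb, Real.rpow_natCast, ← Real.sqrt_eq_rpow,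
    Real.sqrt_div pi_pos.le]
  have := Real.sqrt_pos.2 hb
  norm_num [Nat.doubleFactorial]
  field_simp

/-- An even quartic polynomial integrated against an unnormalised Gaussian with mean `m`. -/
theorem integral_quartic_mul_exp_neg_mul_sq {b : ℝ} (hb : 0 < b) (m u v w : ℝ) {σ : ℝ}
    (hσ : 0 < σ) :
    ∫ y : ℝ, (u + v * ((y - m) / σ) ^ 2 + w * ((y - m) / σ) ^ 4) *
        Real.exp (-b * ((y - m) / σ) ^ 2) =
      σ * √(π / b) * (u + v / (2 * b) + w * 3 / (4 * b ^ 2)) := by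
  let f : ℝ → ℝ := fun z => (u + v * z ^ 2 + w * z ^ 4) * Real.exp (-b * z ^ 2)
  have h1 : ∫ y : ℝ, f ((y - m) / σ) = σ * ∫ z, f z := by
    rw [integral_sub_right_eq_self (fun y => f (y / σ)) m, Measure.integral_comp_div,
      abs_of_pos hσ, smul_eq_mul]
  have i0 : Integrable fun z : ℝ => u * Real.exp (-b * z ^ 2) :=
    (integrable_exp_neg_mul_sq hb).const_mul u
  have i2 := (integrable_pow_mul_exp_neg_mul_sq hb 2).const_mul v
  have i4 := (integrable_pow_mul_exp_neg_mul_sq hb 4).const_mul w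
  have h2 : ∫ z, f z = √(π / b) * (u + v / (2 * b) + w * 3 / (4 * b ^ 2)) := by
    have e : f = fun z => (u * Real.exp (-b * z ^ 2) + v * (z ^ 2 * Real.exp (-b * z ^ 2))) +
        w * (z ^ 4 * Real.exp (-b * z ^ 2)) := by
      funext z; simp only [f]; ring
    have i02 : Integrable fun z : ℝ =>
        u * Real.exp (-b * z ^ 2) + v * (z ^ 2 * Real.exp (-b * z ^ 2)) := i0.add i2
    simp only [e]
    rw [integral_add i02 i4, integral_add i0 i2, integral_const_mul,
      integral_const_mul, integral_const_mul, integral_gaussian,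
      integral_sq_mul_exp_neg_mul_sq hb, integral_pow_four_mul_exp_neg_mul_sq hb]
    ring
  change ∫ y : ℝ, f ((y - m) / σ) = _
  rw [h1, h2, mul_assoc]

/-- The derivative of the normal density with respect to its scale parameter. -/
theorem hasDerivAt_normal_density_scale (m y : ℝ) {σ : ℝ} (hσ : 0 < σ) :
    HasDerivAt (fun s : ℝ => (s * √(2 * π))⁻¹ * Real.exp (-((y - m) ^ 2) / (2 * s ^ 2)))
      ((σ * √(2 * π))⁻¹ * Real.exp (-(1 / 2) * ((y - m) / σ) ^ 2) *
        ((((y - m) / σ) ^ 2 - 1) / σ)) σ := by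
  have hr : 0 < √(2 * π) := Real.sqrt_pos.2 (by positivity)
  have h1 : HasDerivAt (fun s : ℝ => (s * √(2 * π))⁻¹) _ σ :=
    ((hasDerivAt_id σ).mul_const (√(2 * π))).inv (mul_pos hσ hr).ne'
  have h2 : HasDerivAt (fun s : ℝ => -((y - m) ^ 2) / (2 * s ^ 2)) _ σ :=
    (hasDerivAt_const σ (-((y - m) ^ 2))).div (((hasDerivAt_pow 2 σ)).const_mul 2)
      (by positivity)
  refine (h1.mul h2.exp).congr_deriv ?_
  rw [show -((y - m) ^ 2) / (2 * σ ^ 2) = -(1 / 2) * ((y - m) / σ) ^ 2 by field_simp]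
  simp only [id]
  field_simp
  push_cast
  ring

/-- Influence function of the minimum `R_α`-estimator of the scale parameter `σ` in the normal
model with known mean `m`:
`M_α(σ)⁻¹ [p_σ^{α−1}(x) ṗ_σ(x) − c_α(σ) p_σ^α(x)]
  = (σ(α+1)^{5/2}/2)(((x−m)/σ)² − 1/(α+1)) exp(−(α/2)((x−m)/σ)²)`. -/
theorem scale_normal_influence_function (m σ α : ℝ) (hσ : 0 < σ) (hα : 0 < α)
    (p : ℝ → ℝ → ℝ)
    (hp : ∀ s y, p s y = (s * Real.sqrt (2 * π))⁻¹ * Real.exp (-((y - m) ^ 2) / (2 * s ^ 2)))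
    (pdot : ℝ → ℝ) (hpdot : ∀ y, pdot y = deriv (fun s => p s y) σ)
    (c M : ℝ)
    (hc : c = (∫ y, p σ y ^ α * pdot y) / ∫ y, p σ y ^ (α + 1))
    (hM : M = (∫ y, p σ y ^ (α - 1) * pdot y ^ 2) -
        (∫ y, p σ y ^ α * pdot y) ^ 2 / ∫ y, p σ y ^ (α + 1)) :
    ∀ x : ℝ,
      M⁻¹ * (p σ x ^ (α - 1) * pdot x - c * p σ x ^ α) =
        σ * (α + 1) ^ ((5 : ℝ) / 2) / 2 * (((x - m) / σ) ^ 2 - 1 / (α + 1)) *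
          Real.exp (-(α / 2) * ((x - m) / σ) ^ 2) := by
  intro x
  obtain ⟨K, hK⟩ : ∃ K, K = (σ * √(2 * π))⁻¹ := ⟨_, rfl⟩
  have hK0 : 0 < K := by rw [hK]; positivity
  have hpσ (y) : p σ y = K * Real.exp (-(1 / 2) * ((y - m) / σ) ^ 2) := by
    rw [hp, hK, show -((y - m) ^ 2) / (2 * σ ^ 2) = -(1 / 2) * ((y - m) / σ) ^ 2 by field_simp]
  have hp0 (y) : 0 < p σ y := by rw [hpσ]; positivity
  have hd (y) : pdot y = p σ y * ((((y - m) / σ) ^ 2 - 1) / σ) := by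
    rw [hpdot, funext fun s => hp s y, (hasDerivAt_normal_density_scale m y hσ).deriv, hpσ, hK]
  have hpow (t y : ℝ) : p σ y ^ t = K ^ t * Real.exp (-(t / 2) * ((y - m) / σ) ^ 2) := by
    rw [hpσ, Real.mul_rpow hK0.le (Real.exp_pos _).le, ← Real.exp_mul]
    ring_nf
  have hβ : 0 < (α + 1) / 2 := by positivity
  have hα1 : α + 1 ≠ 0 := by positivity
  have I0 : ∫ y, p σ y ^ (α + 1) = K ^ (α + 1) * (σ * √(π / ((α + 1) / 2))) := by
    have h := integral_quartic_mul_exp_neg_mul_sq hβ m (K ^ (α + 1)) 0 0 hσ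
    simp only [zero_mul, add_zero, zero_div] at h
    simp only [hpow, h]
    ring
  have I1 : ∫ y, p σ y ^ α * pdot y =
      K ^ (α + 1) * (σ * √(π / ((α + 1) / 2))) * ((1 / (α + 1) - 1) / σ) := by
    have h := integral_quartic_mul_exp_neg_mul_sq hβ m (-K ^ (α + 1) / σ) (K ^ (α + 1) / σ) 0 hσ
    have e (y) : p σ y ^ α * pdot y = (-K ^ (α + 1) / σ + K ^ (α + 1) / σ * ((y - m) / σ) ^ 2 +
        0 * ((y - m) / σ) ^ 4) * Real.exp (-((α + 1) / 2) * ((y - m) / σ) ^ 2) := by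
      rw [hd, ← mul_assoc, ← Real.rpow_add_one (hp0 y).ne', hpow]
      ring
    simp only [e, h]
    field_simp
    ring
  have I2 : ∫ y, p σ y ^ (α - 1) * pdot y ^ 2 = K ^ (α + 1) * (σ * √(π / ((α + 1) / 2))) *
      ((3 / (α + 1) ^ 2 - 2 / (α + 1) + 1) / σ ^ 2) := by
    have h := integral_quartic_mul_exp_neg_mul_sq hβ m (K ^ (α + 1) / σ ^ 2)
      (-2 * K ^ (α + 1) / σ ^ 2) (K ^ (α + 1) / σ ^ 2) hσ
    have e (y) : p σ y ^ (α - 1) * pdot y ^ 2 = (K ^ (α + 1) / σ ^ 2 +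
        -2 * K ^ (α + 1) / σ ^ 2 * ((y - m) / σ) ^ 2 + K ^ (α + 1) / σ ^ 2 * ((y - m) / σ) ^ 4) *
          Real.exp (-((α + 1) / 2) * ((y - m) / σ) ^ 2) := by
      have e1 : p σ y ^ (α - 1) * p σ y ^ 2 = p σ y ^ (α + 1) := by
        rw [← Real.rpow_natCast (p σ y) 2, ← Real.rpow_add (hp0 y)]
        congr 1
        push_cast
        ring
      rw [hd, mul_pow, ← mul_assoc, e1, hpow]
      ring
    simp only [e, h]
    field_simp
    ring
  have hnum : p σ x ^ (α - 1) * pdot x = p σ x ^ α * ((((x - m) / σ) ^ 2 - 1) / σ) := by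
    rw [hd, ← mul_assoc, ← Real.rpow_add_one (hp0 x).ne', sub_add_cancel]
  have hs : 0 < √(α + 1) := Real.sqrt_pos.2 (by positivity)
  have hKI : K * (σ * √(π / ((α + 1) / 2))) = (√(α + 1))⁻¹ := by
    have hr : 0 < √(2 * π) := Real.sqrt_pos.2 (by positivity)
    rw [hK, show π / ((α + 1) / 2) = 2 * π / (α + 1) by field_simp,
      Real.sqrt_div (by positivity)]
    field_simp
  have h52 : (α + 1) ^ ((5 : ℝ) / 2) = (α + 1) ^ 2 * √(α + 1) := by
    rw [show (5 : ℝ) / 2 = (2 : ℕ) + 1 / 2 by norm_num, Real.rpow_add (by positivity),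
      Real.rpow_natCast, ← Real.sqrt_eq_rpow]
  have hA : K ^ (α + 1) * (σ * √(π / ((α + 1) / 2))) = K ^ α * (√(α + 1))⁻¹ := by
    rw [Real.rpow_add_one hK0.ne', mul_assoc, hKI]
  have hKα : 0 < K ^ α := Real.rpow_pos_of_pos hK0 α
  rw [I0, I1, hA] at hc
  rw [I0, I1, I2, hA] at hM
  have hc' : c = (1 / (α + 1) - 1) / σ := by
    rw [hc]
    field_simp
  have hM' : M = K ^ α * (√(α + 1))⁻¹ * (2 / ((α + 1) ^ 2 * σ ^ 2)) := by
    rw [hM]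
    field_simp
    ring
  rw [hnum, hpow, hc', hM', h52]
  field_simp
  ring
end

section
/- For α > 0, σ > 0 and m ∈ ℝ, the supremum over x ∈ ℝ of the absolute value of the influence function of the minimum R_α-estimator of the scale parameter in the normal model, namely sup_{x∈ℝ} | (σ(α+1)^{5/2}/2) · [ ((x−m)/σ)² − 1/(α+1) ] · exp( −(α/2)((x−m)/σ)² ) |, equals max{ σ(α+1)^{3/2}/2 , (σ(α+1)^{5/2}/α) · exp( −(3α+2)/(2(α+1)) ) }. In particular this gross error sensitivity is finite, so the estimator is B-robust, and the value does not depend on m. -/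
open Real

/-- The function `t ↦ (t - c) * exp (-a t)` is bounded above by its value at `t = c + 1 / a`. -/
theorem sub_mul_exp_neg_mul_le {a : ℝ} (ha : 0 < a) (c t : ℝ) :
    (t - c) * Real.exp (-a * t) ≤ 1 / a * Real.exp (-1 - a * c) := by
  have h : a * (t - c) ≤ Real.exp (a * (t - c) - 1) := by
    linarith [Real.add_one_le_exp (a * (t - c) - 1)]
  have h' : a * (t - c) * Real.exp (-a * t) ≤ Real.exp (-1 - a * c) := by
    refine (mul_le_mul_of_nonneg_right h (Real.exp_pos _).le).trans_eq ?_
    rw [← Real.exp_add]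
    ring_nf
  rw [one_div_mul_eq_div, le_div_iff₀ ha]
  linarith

/-- On `t ≥ 0`, the function `t ↦ (t - c) * exp (-a t)` is bounded below by its value at `0`. -/
theorem neg_le_sub_mul_exp_neg_mul {a c t : ℝ} (ha : 0 ≤ a) (hc : 0 ≤ c) (ht : 0 ≤ t) :
    -c ≤ (t - c) * Real.exp (-a * t) := by
  have h1 : Real.exp (-a * t) ≤ 1 := Real.exp_le_one_iff.2 (by nlinarith)
  nlinarith [mul_nonneg ht (Real.exp_pos (-a * t)).le]

theorem abs_sub_mul_exp_neg_mul_le {a c t : ℝ} (ha : 0 < a) (hc : 0 ≤ c) (ht : 0 ≤ t) :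
    |(t - c) * Real.exp (-a * t)| ≤ max c (1 / a * Real.exp (-1 - a * c)) :=
  abs_le.2 ⟨(neg_le_neg (le_max_left _ _)).trans (neg_le_sub_mul_exp_neg_mul ha.le hc ht),
    (sub_mul_exp_neg_mul_le ha c t).trans (le_max_right _ _)⟩

/-- The absolute value of `(u ^ 2 - c) * exp (-a u ^ 2)` is maximal at `u = 0` or at
`u ^ 2 = c + 1 / a`. -/
theorem isGreatest_range_abs_sq_sub_mul_exp {a c σ : ℝ} (ha : 0 < a) (hc : 0 ≤ c) (hσ : σ ≠ 0)
    (m : ℝ) :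
    IsGreatest
      (Set.range fun x : ℝ =>
        |(((x - m) / σ) ^ 2 - c) * Real.exp (-a * ((x - m) / σ) ^ 2)|)
      (max c (1 / a * Real.exp (-1 - a * c))) := by
  refine ⟨?_, ?_⟩
  · rcases max_choice c (1 / a * Real.exp (-1 - a * c)) with h | h <;> rw [h]
    · exact ⟨m, by simp [abs_of_nonneg hc]⟩
    · refine ⟨m + σ * √(c + 1 / a), ?_⟩
      have hx : ((m + σ * √(c + 1 / a) - m) / σ) ^ 2 = c + 1 / a := by
        rw [add_sub_cancel_left, mul_div_cancel_left₀ _ hσ, Real.sq_sqrt (by positivity)]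
      have he : -a * (c + 1 / a) = -1 - a * c := by
        field_simp
        ring
      beta_reduce
      rw [hx, he, add_sub_cancel_left]
      exact abs_of_nonneg (by positivity)
  · rintro _ ⟨x, rfl⟩
    exact abs_sub_mul_exp_neg_mul_le ha hc (sq_nonneg _)

/-- Gross error sensitivity of the minimum `R_α`-estimator of the scale parameter in the
normal model: the supremum over `x` of the absolute influence function equals
`max{σ(α+1)^{3/2}/2, (σ(α+1)^{5/2}/α) exp(−(3α+2)/(2(α+1)))}`; in particular the influence
function is bounded (B-robustness) and the value does not depend on `m`. -/
theorem scale_normal_gross_error_sensitivity (α σ m : ℝ) (hα : 0 < α) (hσ : 0 < σ) :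
    (⨆ x : ℝ, |σ * (α + 1) ^ ((5 : ℝ) / 2) / 2 * (((x - m) / σ) ^ 2 - 1 / (α + 1)) *
          Real.exp (-(α / 2) * ((x - m) / σ) ^ 2)|) =
        max (σ * (α + 1) ^ ((3 : ℝ) / 2) / 2)
          (σ * (α + 1) ^ ((5 : ℝ) / 2) / α * Real.exp (-(3 * α + 2) / (2 * (α + 1)))) ∧
      BddAbove (Set.range fun x : ℝ =>
        |σ * (α + 1) ^ ((5 : ℝ) / 2) / 2 * (((x - m) / σ) ^ 2 - 1 / (α + 1)) *
          Real.exp (-(α / 2) * ((x - m) / σ) ^ 2)|) := by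
  set K : ℝ := σ * (α + 1) ^ ((5 : ℝ) / 2) / 2 with hK
  have hα1 : 0 < α + 1 := by linarith
  have hK0 : 0 ≤ K := by positivity
  have hG := isGreatest_range_abs_sq_sub_mul_exp (a := α / 2) (c := 1 / (α + 1)) (half_pos hα)
    (by positivity) hσ.ne' m
  have hpow : (α + 1) ^ ((5 : ℝ) / 2) = (α + 1) ^ ((3 : ℝ) / 2) * (α + 1) := by
    rw [← Real.rpow_add_one hα1.ne']
    norm_num
  have hleft : σ * (α + 1) ^ ((3 : ℝ) / 2) / 2 = K * (1 / (α + 1)) := by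
    rw [hK, hpow]
    field_simp
  have hexp : -(3 * α + 2) / (2 * (α + 1)) = -1 - α / 2 * (1 / (α + 1)) := by
    field_simp
    ring
  have hright : σ * (α + 1) ^ ((5 : ℝ) / 2) / α * Real.exp (-(3 * α + 2) / (2 * (α + 1))) =
      K * (1 / (α / 2) * Real.exp (-1 - α / 2 * (1 / (α + 1)))) := by
    rw [hexp, hK]
    field_simp
  rw [hleft, hright, ← mul_max_of_nonneg _ _ hK0]
  simp only [mul_assoc K, abs_mul K, abs_of_nonneg hK0]
  refine ⟨?_, ?_⟩
  · rw [← Real.mul_iSup_of_nonneg hK0]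
    exact congrArg (K * ·) hG.csSup_eq
  · obtain ⟨B, hB⟩ := hG.bddAbove
    refine ⟨K * B, ?_⟩
    rintro _ ⟨x, rfl⟩
    exact mul_le_mul_of_nonneg_left (hB ⟨x, rfl⟩) hK0
end

section
/- For α > 0, σ > 0 and m ∈ ℝ, the supremum over x ∈ ℝ of the absolute value of the influence function of the minimum R_α-estimator of the location parameter in the normal model, namely sup_{x∈ℝ} | (α+1)^{3/2} · (x−m) · exp( −(α/2)((x−m)/σ)² ) |, equals (α+1)^{3/2} · (σ/√α) · e^{−1/2}. In particular this gross error sensitivity is finite, so the estimator is B-robust, and the value does not depend on m. -/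
open Real

/-- The function `|t| exp (-t² / 2)` attains its maximum at `t = 1`. -/
lemma abs_mul_exp_neg_sq_div_two_le (t : ℝ) :
    |t| * Real.exp (-(t ^ 2 / 2)) ≤ Real.exp (-(1 / 2)) := by
  have h : |t| ≤ Real.exp ((t ^ 2 - 1) / 2) := by
    refine abs_le_of_sq_le_sq ?_ (Real.exp_pos _).le
    rw [← Real.exp_nat_mul]
    calc t ^ 2 = (t ^ 2 - 1) + 1 := by ring
      _ ≤ Real.exp (t ^ 2 - 1) := Real.add_one_le_exp _
      _ = _ := by congr 1; push_cast; ring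
  calc |t| * Real.exp (-(t ^ 2 / 2))
      ≤ Real.exp ((t ^ 2 - 1) / 2) * Real.exp (-(t ^ 2 / 2)) := by gcongr
    _ = Real.exp (-(1 / 2)) := by rw [← Real.exp_add]; congr 1; ring

/-- Gross error sensitivity of the minimum `R_α`-estimator of the location parameter in the
normal model: the supremum over `x` of the absolute influence function equals
`(α+1)^{3/2}(σ/√α) e^{−1/2}`; in particular the influence function is bounded
(B-robustness) and the value does not depend on `m`. -/
theorem location_normal_gross_error_sensitivity (α σ m : ℝ) (hα : 0 < α) (hσ : 0 < σ) :
    (⨆ x : ℝ, |(α + 1) ^ ((3 : ℝ) / 2) * (x - m) *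
          Real.exp (-(α / 2) * ((x - m) / σ) ^ 2)|) =
        (α + 1) ^ ((3 : ℝ) / 2) * (σ / Real.sqrt α) * Real.exp (-(1 / 2)) ∧
      BddAbove (Set.range fun x : ℝ =>
        |(α + 1) ^ ((3 : ℝ) / 2) * (x - m) * Real.exp (-(α / 2) * ((x - m) / σ) ^ 2)|) := by
  have hs : 0 < Real.sqrt α := Real.sqrt_pos.mpr hα
  have hsq : Real.sqrt α ^ 2 = α := Real.sq_sqrt hα.le
  have hc : 0 < (α + 1) ^ ((3 : ℝ) / 2) := by positivity
  have key (x : ℝ) :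
      |(α + 1) ^ ((3 : ℝ) / 2) * (x - m) * Real.exp (-(α / 2) * ((x - m) / σ) ^ 2)| =
        (α + 1) ^ ((3 : ℝ) / 2) * (σ / Real.sqrt α) *
          (|Real.sqrt α * (x - m) / σ| *
            Real.exp (-((Real.sqrt α * (x - m) / σ) ^ 2 / 2))) := by
    have harg : -(α / 2) * ((x - m) / σ) ^ 2 = -((Real.sqrt α * (x - m) / σ) ^ 2 / 2) := by
      rw [div_pow, div_pow, mul_pow, hsq]
      ring
    rw [harg, abs_mul, abs_mul, Real.abs_exp, abs_of_pos hc, abs_div, abs_mul,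
      abs_of_pos hs, abs_of_pos hσ]
    field_simp
  have hmax : IsGreatest (Set.range fun x : ℝ =>
      |(α + 1) ^ ((3 : ℝ) / 2) * (x - m) * Real.exp (-(α / 2) * ((x - m) / σ) ^ 2)|)
      ((α + 1) ^ ((3 : ℝ) / 2) * (σ / Real.sqrt α) * Real.exp (-(1 / 2))) := by
    refine ⟨⟨m + σ / Real.sqrt α, ?_⟩, ?_⟩
    · have ht : Real.sqrt α * (m + σ / Real.sqrt α - m) / σ = 1 := by
        field_simp
        ring
      simp only [key, ht, abs_one, one_mul, one_pow]
    · rintro _ ⟨x, rfl⟩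
      simp only [key]
      gcongr
      exact abs_mul_exp_neg_sq_div_two_le _
  exact ⟨hmax.csSup_eq, hmax.bddAbove⟩
end

section
/- Consider the exponential family p_θ(x) = θ^{-1} exp(−x/θ) for x ≥ 0, θ > 0, and let ṗ_θ = ∂p_θ/∂θ. For α > 0 define c_α(θ) = (∫ p_θ^α ṗ_θ dλ)/(∫ p_θ^{α+1} dλ) and M_α(θ) = ∫ p_θ^{α−1} ṗ_θ² dλ − (∫ p_θ^α ṗ_θ dλ)² / ∫ p_θ^{α+1} dλ, the integrals being over [0,∞). Then for every x ≥ 0, M_α(θ)^{-1} · [ p_θ^{α−1}(x) ṗ_θ(x) − c_α(θ) p_θ^α(x) ] = θ(α+1)³ · ( x/θ − 1/(α+1) ) · exp( −αx/θ ); i.e., the influence function of the minimum R_α-estimator of θ equals this explicit expression, which is bounded in x, so the estimator is B-robust. -/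
open MeasureTheory Real

theorem integral_pow_mul_exp_neg_mul (n : ℕ) {b : ℝ} (hb : 0 < b) :
    ∫ y in Set.Ici (0 : ℝ), y ^ n * Real.exp (-(b * y)) = n.factorial / b ^ (n + 1) := by
  rw [integral_Ici_eq_integral_Ioi]
  have h := Real.integral_rpow_mul_exp_neg_mul_Ioi (a := n + 1) (by positivity) hb
  simp only [add_sub_cancel_right, Real.rpow_natCast, Real.Gamma_nat_eq_factorial] at h
  rw [h, ← Nat.cast_succ, Real.rpow_natCast, div_pow, one_pow]
  field_simp

theorem integrableOn_pow_mul_exp_neg_mul (n : ℕ) {b : ℝ} (hb : 0 < b) :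
    IntegrableOn (fun y : ℝ => y ^ n * Real.exp (-(b * y))) (Set.Ici 0) := by
  by_contra h
  have h0 := integral_undef h
  rw [integral_pow_mul_exp_neg_mul n hb] at h0
  have : (0 : ℝ) < n.factorial / b ^ (n + 1) := by positivity
  exact this.ne' h0

theorem integral_quadratic_mul_exp_neg_mul (r s t : ℝ) {b : ℝ} (hb : 0 < b) :
    ∫ y in Set.Ici (0 : ℝ), (r + s * y + t * y ^ 2) * Real.exp (-(b * y)) =
      r / b + s / b ^ 2 + 2 * t / b ^ 3 := by
  have hi := fun n : ℕ => integrableOn_pow_mul_exp_neg_mul n hb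
  have hsplit : (fun y : ℝ => (r + s * y + t * y ^ 2) * Real.exp (-(b * y))) =
      fun y => r * (y ^ 0 * Real.exp (-(b * y))) + s * (y ^ 1 * Real.exp (-(b * y))) +
        t * (y ^ 2 * Real.exp (-(b * y))) := by
    funext y
    ring
  have h01 : IntegrableOn (fun y : ℝ => r * (y ^ 0 * Real.exp (-(b * y))) +
      s * (y ^ 1 * Real.exp (-(b * y)))) (Set.Ici 0) :=
    ((hi 0).const_mul r).add ((hi 1).const_mul s)
  rw [hsplit, integral_add h01 ((hi 2).const_mul t),
    integral_add ((hi 0).const_mul r) ((hi 1).const_mul s), integral_const_mul,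
    integral_const_mul, integral_const_mul, integral_pow_mul_exp_neg_mul 0 hb,
    integral_pow_mul_exp_neg_mul 1 hb, integral_pow_mul_exp_neg_mul 2 hb]
  norm_num [Nat.factorial]
  ring

theorem hasDerivAt_exponential_density {θ : ℝ} (hθ : θ ≠ 0) (y : ℝ) :
    HasDerivAt (fun t : ℝ => t⁻¹ * Real.exp (-y / t))
      (θ⁻¹ ^ 2 * (y / θ - 1) * Real.exp (-y / θ)) θ := by
  have h := (hasDerivAt_inv hθ).mul (((hasDerivAt_inv hθ).const_mul (-y)).exp)
  simp only [← div_eq_mul_inv] at h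
  refine h.congr_deriv ?_
  field_simp
  ring

theorem exponential_density_rpow {θ : ℝ} (hθ : 0 < θ) (a y : ℝ) :
    (θ⁻¹ * Real.exp (-y / θ)) ^ a = θ⁻¹ ^ a * Real.exp (-(a * y) / θ) := by
  rw [Real.mul_rpow (by positivity) (by positivity), ← Real.exp_mul]
  congr 2
  ring

theorem abs_sub_mul_exp_neg_le {α u v : ℝ} (hα : 0 < α) (hu : 0 ≤ u) (hv : 0 ≤ v) :
    |u - v| * Real.exp (-(α * u)) ≤ 1 / α + v := by
  have h1 : |u - v| ≤ u + v := abs_le.2 ⟨by linarith, by linarith⟩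
  have h2 : u * Real.exp (-(α * u)) ≤ 1 / α := by
    rw [Real.exp_neg, ← div_eq_mul_inv, div_le_div_iff₀ (Real.exp_pos _) hα]
    linarith [Real.add_one_le_exp (α * u)]
  have h3 : Real.exp (-(α * u)) ≤ 1 := Real.exp_le_one_iff.2 (by nlinarith)
  calc |u - v| * Real.exp (-(α * u)) ≤ (u + v) * Real.exp (-(α * u)) := by gcongr
    _ = u * Real.exp (-(α * u)) + v * Real.exp (-(α * u)) := by ring
    _ ≤ 1 / α + v := add_le_add h2 (mul_le_of_le_one_right hv h3)

/-- Influence function of the minimum `R_α`-estimator of the parameter `θ` of the exponential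
model `p_θ(x) = θ⁻¹ e^{−x/θ}` on `[0,∞)`:
`M_α(θ)⁻¹ [p_θ^{α−1}(x) ṗ_θ(x) − c_α(θ) p_θ^α(x)] = θ(α+1)³ (x/θ − 1/(α+1)) e^{−αx/θ}`,
which is bounded in `x`, so the estimator is B-robust. -/
theorem exponential_influence_function (θ α : ℝ) (hθ : 0 < θ) (hα : 0 < α)
    (p : ℝ → ℝ → ℝ) (hp : ∀ t y, p t y = t⁻¹ * Real.exp (-y / t))
    (pdot : ℝ → ℝ) (hpdot : ∀ y, pdot y = deriv (fun t => p t y) θ)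
    (c M : ℝ)
    (hc : c = (∫ y in Set.Ici (0 : ℝ), p θ y ^ α * pdot y) /
        ∫ y in Set.Ici (0 : ℝ), p θ y ^ (α + 1))
    (hM : M = (∫ y in Set.Ici (0 : ℝ), p θ y ^ (α - 1) * pdot y ^ 2) -
        (∫ y in Set.Ici (0 : ℝ), p θ y ^ α * pdot y) ^ 2 /
          ∫ y in Set.Ici (0 : ℝ), p θ y ^ (α + 1)) :
    (∀ x : ℝ, 0 ≤ x →
        M⁻¹ * (p θ x ^ (α - 1) * pdot x - c * p θ x ^ α) =
          θ * (α + 1) ^ 3 * (x / θ - 1 / (α + 1)) * Real.exp (-(α * x) / θ)) ∧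
      ∃ B : ℝ, ∀ x : ℝ, 0 ≤ x →
        |θ * (α + 1) ^ 3 * (x / θ - 1 / (α + 1)) * Real.exp (-(α * x) / θ)| ≤ B := by
  have ha : 0 < α + 1 := by linarith
  have hb : 0 < (α + 1) / θ := by positivity
  set K : ℝ := θ⁻¹ ^ α with hK
  have hK0 : 0 < K := by positivity
  have hKadd : θ⁻¹ ^ (α + 1) = K * θ⁻¹ := Real.rpow_add_one (by positivity) α
  have hKsub : θ⁻¹ ^ (α - 1) = K / θ⁻¹ := Real.rpow_sub_one (by positivity) α
  have hpow : ∀ a y, p θ y ^ a = θ⁻¹ ^ a * Real.exp (-(a * y) / θ) := fun a y => by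
    rw [hp, exponential_density_rpow hθ]
  have hdot : ∀ y, pdot y = θ⁻¹ ^ 2 * (y / θ - 1) * Real.exp (-y / θ) := fun y => by
    rw [hpdot, funext fun t => hp t y]
    exact (hasDerivAt_exponential_density hθ.ne' y).deriv
  have hI0 : ∫ y in Set.Ici (0 : ℝ), p θ y ^ (α + 1) = K / (α + 1) := by
    have h : (fun y => p θ y ^ (α + 1)) = fun y =>
        (K * θ⁻¹ + 0 * y + 0 * y ^ 2) * Real.exp (-((α + 1) / θ * y)) := by
      funext y
      rw [hpow, hKadd, show -((α + 1) * y) / θ = -((α + 1) / θ * y) by ring]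
      ring
    rw [h, integral_quadratic_mul_exp_neg_mul _ _ _ hb]
    field_simp
    ring
  have hI1 : ∫ y in Set.Ici (0 : ℝ), p θ y ^ α * pdot y =
      K / θ * (1 / (α + 1) ^ 2 - 1 / (α + 1)) := by
    have h : (fun y => p θ y ^ α * pdot y) = fun y =>
        (-(K / θ ^ 2) + K / θ ^ 3 * y + 0 * y ^ 2) * Real.exp (-((α + 1) / θ * y)) := by
      funext y
      rw [hpow, ← hK, hdot,
        show -((α + 1) / θ * y) = -(α * y) / θ + -y / θ by ring, Real.exp_add]
      field_simp
      ring
    rw [h, integral_quadratic_mul_exp_neg_mul _ _ _ hb]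
    field_simp
    ring
  have hI2 : ∫ y in Set.Ici (0 : ℝ), p θ y ^ (α - 1) * pdot y ^ 2 =
      K / θ ^ 2 * (2 / (α + 1) ^ 3 - 2 / (α + 1) ^ 2 + 1 / (α + 1)) := by
    have h : (fun y => p θ y ^ (α - 1) * pdot y ^ 2) = fun y =>
        (K / θ ^ 3 + -(2 * K / θ ^ 4) * y + K / θ ^ 5 * y ^ 2) *
          Real.exp (-((α + 1) / θ * y)) := by
      funext y
      rw [hpow, hdot, hKsub,
        show -((α + 1) / θ * y) = -((α - 1) * y) / θ + (-y / θ + -y / θ) by ring,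
        Real.exp_add, Real.exp_add]
      field_simp
      ring
    rw [h, integral_quadratic_mul_exp_neg_mul _ _ _ hb]
    field_simp
    ring
  have hc' : c = (1 / (α + 1) - 1) / θ := by
    rw [hc, hI0, hI1]
    field_simp
  have hM' : M = K / (θ ^ 2 * (α + 1) ^ 3) := by
    rw [hM, hI0, hI1, hI2]
    field_simp
    ring
  refine ⟨fun x _ => ?_, θ * (α + 1) ^ 3 * (1 / α + 1 / (α + 1)), fun x hx => ?_⟩
  · rw [hM', hc', hpow, hpow, ← hK, hdot, hKsub,
      show -(α * x) / θ = -((α - 1) * x) / θ + -x / θ by ring, Real.exp_add]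
    field_simp
    ring
  · rw [abs_mul, abs_mul, abs_of_pos (Real.exp_pos _), abs_of_pos (by positivity), mul_assoc,
      show -(α * x) / θ = -(α * (x / θ)) by ring]
    gcongr
    exact abs_sub_mul_exp_neg_le hα (by positivity) (by positivity)
end
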